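/- Let W(V) be the Weyl algebra of a finite-dimensional symplectic vector space V (generated by V with relations uv − vu = ω(u,v)), carrying the filtration with V in degree 1. Suppose A ⊆ W(V) is a filtered subalgebra and Z ⊆ A a central subalgebra such that the associated graded algebra gr A is a finite module over gr Z. Then A is commutative. -/

import Mathlib

open scoped BigOperators

/-- The defining relations of the Weyl algebra of `(V, ω)`. -/
inductive WeylRel {V : Type*} [AddCommGroup V] [Module ℂ V]
    (ω : V →ₗ[ℂ] V →ₗ[ℂ] ℂ) : FreeAlgebra ℂ V → FreeAlgebra ℂ V → Prop
  | commutator (u v : V) :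
      WeylRel ω (FreeAlgebra.ι ℂ u * FreeAlgebra.ι ℂ v)
        (FreeAlgebra.ι ℂ v * FreeAlgebra.ι ℂ u + algebraMap ℂ (FreeAlgebra ℂ V) (ω u v))

/-- The Weyl algebra of `(V, ω)`: generated by `V` with `uv − vu = ω(u,v)`. -/
abbrev WeylAlgebra {V : Type*} [AddCommGroup V] [Module ℂ V]
    (ω : V →ₗ[ℂ] V →ₗ[ℂ] ℂ) :=
  RingQuot (WeylRel ω)

/-- Generators of the Weyl algebra. -/
noncomputable def weylGen {V : Type*} [AddCommGroup V] [Module ℂ V]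
    (ω : V →ₗ[ℂ] V →ₗ[ℂ] ℂ) (v : V) : WeylAlgebra ω :=
  RingQuot.mkAlgHom ℂ (WeylRel ω) (FreeAlgebra.ι ℂ v)

/-- The canonical (Bernstein) filtration of the Weyl algebra, with `V` in degree 1. -/
noncomputable def weylFil {V : Type*} [AddCommGroup V] [Module ℂ V]
    (ω : V →ₗ[ℂ] V →ₗ[ℂ] ℂ) (n : ℕ) : Submodule ℂ (WeylAlgebra ω) :=
  Submodule.span ℂ {w | ∃ l : List V, l.length ≤ n ∧ w = (l.map (weylGen ω)).prod}

namespace WeylAux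
set_option linter.unusedSectionVars false
open MvPolynomial

variable {V : Type*} [AddCommGroup V] [Module ℂ V] (ω : V →ₗ[ℂ] V →ₗ[ℂ] ℂ)

/-- product of generators -/
noncomputable def gp (l : List V) : WeylAlgebra ω := (l.map (weylGen ω)).prod

lemma gp_nil : gp ω [] = 1 := by simp [gp]
lemma gp_cons (v : V) (l : List V) : gp ω (v :: l) = weylGen ω v * gp ω l := by simp [gp]
lemma gp_append (l l' : List V) : gp ω (l ++ l') = gp ω l * gp ω l' := by simp [gp]

/-- strict filtration -/
noncomputable def G (n : ℕ) : Submodule ℂ (WeylAlgebra ω) :=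
  Submodule.span ℂ {w | ∃ l : List V, l.length < n ∧ w = gp ω l}

lemma fil_eq (n : ℕ) : weylFil ω n = G ω (n+1) := by
  unfold weylFil G gp
  simp only [Nat.lt_succ_iff]

lemma G_zero : G ω 0 = ⊥ := by simp [G]

lemma G_mono {m n : ℕ} (h : m ≤ n) : G ω m ≤ G ω n := by
  apply Submodule.span_mono
  rintro w ⟨l, hl, rfl⟩
  exact ⟨l, by omega, rfl⟩

lemma fil_mono {m n : ℕ} (h : m ≤ n) : weylFil ω m ≤ weylFil ω n := by
  simp only [fil_eq]; exact G_mono ω (by omega)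

lemma fil_le_G {m n : ℕ} (h : m < n) : weylFil ω m ≤ G ω n := by
  simp only [fil_eq]; exact G_mono ω (by omega)

lemma G_le_fil (n : ℕ) : G ω n ≤ weylFil ω n := by
  simp only [fil_eq]; exact G_mono ω (by omega)

lemma gp_mem (l : List V) : gp ω l ∈ weylFil ω l.length :=
  Submodule.subset_span ⟨l, le_rfl, rfl⟩

lemma G_mul_G {i j k : ℕ} (h : ∀ a b, a < i → b < j → a + b < k) {x y : WeylAlgebra ω}
    (hx : x ∈ G ω i) (hy : y ∈ G ω j) : x * y ∈ G ω k := by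
  have : x * y ∈ G ω i * G ω j := Submodule.mul_mem_mul hx hy
  refine (?_ : G ω i * G ω j ≤ G ω k) this
  unfold G
  rw [Submodule.span_mul_span, Submodule.span_le]
  rintro _ ⟨_, ⟨l, hl, rfl⟩, _, ⟨l', hl', rfl⟩, rfl⟩
  refine Submodule.subset_span ⟨l ++ l', ?_, by simp [gp_append]⟩
  simpa using h _ _ hl hl'

lemma fil_mul {i j : ℕ} {x y : WeylAlgebra ω}
    (hx : x ∈ weylFil ω i) (hy : y ∈ weylFil ω j) : x * y ∈ weylFil ω (i+j) := by
  rw [fil_eq] at *; exact G_mul_G ω (by omega) hx hy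

lemma fil_mul_G {i j : ℕ} {x y : WeylAlgebra ω}
    (hx : x ∈ weylFil ω i) (hy : y ∈ G ω j) : x * y ∈ G ω (i+j) := by
  rw [fil_eq] at *; exact G_mul_G ω (by omega) hx hy

lemma G_mul_fil {i j : ℕ} {x y : WeylAlgebra ω}
    (hx : x ∈ G ω i) (hy : y ∈ weylFil ω j) : x * y ∈ G ω (i+j) := by
  rw [fil_eq] at *; exact G_mul_G ω (by omega) hx hy

lemma one_mem : (1 : WeylAlgebra ω) ∈ weylFil ω 0 := by
  simpa [gp_nil] using gp_mem ω []

lemma fil_pow {i : ℕ} {x : WeylAlgebra ω} (hx : x ∈ weylFil ω i) (j : ℕ) :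
    x ^ j ∈ weylFil ω (j * i) := by
  induction j with
  | zero => simpa using one_mem ω
  | succ j ih => rw [pow_succ, Nat.succ_mul]; exact fil_mul ω ih hx

lemma fil_zero {x : WeylAlgebra ω} (hx : x ∈ weylFil ω 0) : ∃ c : ℂ, x = algebraMap ℂ _ c := by
  have : weylFil ω 0 ≤ Submodule.span ℂ {1} := by
    apply Submodule.span_mono
    rintro w ⟨l, hl, rfl⟩
    have : l = [] := by simpa using hl
    simp [this]
  obtain ⟨c, hc⟩ := Submodule.mem_span_singleton.1 (this hx)
  exact ⟨c, by rw [← hc, Algebra.algebraMap_eq_smul_one]⟩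

lemma exists_fil (x : WeylAlgebra ω) : ∃ n, x ∈ weylFil ω n := by
  obtain ⟨y, rfl⟩ := RingQuot.mkAlgHom_surjective ℂ (WeylRel ω) x
  induction y using FreeAlgebra.induction with
  | grade0 r =>
    refine ⟨0, ?_⟩
    rw [AlgHom.commutes, Algebra.algebraMap_eq_smul_one]
    exact Submodule.smul_mem _ _ (one_mem ω)
  | grade1 v => exact ⟨1, by simpa [gp, weylGen] using gp_mem ω [v]⟩
  | mul a b ha hb =>
    obtain ⟨n, hn⟩ := ha
    obtain ⟨m, hm⟩ := hb
    exact ⟨n + m, by rw [map_mul]; exact fil_mul ω hn hm⟩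
  | add a b ha hb =>
    obtain ⟨n, hn⟩ := ha
    obtain ⟨m, hm⟩ := hb
    refine ⟨n + m, by
      rw [map_add]
      exact Submodule.add_mem _ (fil_mono ω (by omega) hn) (fil_mono ω (by omega) hm)⟩

lemma gen_comm (u v : V) : weylGen ω u * weylGen ω v =
    weylGen ω v * weylGen ω u + algebraMap ℂ _ (ω u v) := by
  have := RingQuot.mkAlgHom_rel ℂ (WeylRel.commutator (ω := ω) u v)
  simpa [weylGen] using this

lemma perm_sub {l l' : List V} (h : l.Perm l') : gp ω l - gp ω l' ∈ G ω l.length := by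
  induction h with
  | nil => simp
  | cons x h ih =>
    rw [gp_cons, gp_cons, ← mul_sub, List.length_cons, add_comm]
    refine fil_mul_G ω ?_ ih
    simpa [gp] using gp_mem ω [x]
  | swap x y l =>
    simp only [gp_cons, ← mul_assoc]
    rw [← sub_mul, gen_comm ω y x, add_sub_cancel_left, ← Algebra.smul_def]
    exact Submodule.smul_mem _ _ (fil_le_G ω (by simp) (gp_mem ω l))
  | trans h1 h2 ih1 ih2 =>
    rw [← h1.length_eq] at ih2
    simpa using Submodule.add_mem _ ih1 ih2

/-- derivation -/
noncomputable def D (v : V) : Derivation ℂ (MvPolynomial V ℂ) (MvPolynomial V ℂ) :=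
  mkDerivation ℂ (fun u => C (ω v u))

lemma D_X (u v : V) : D ω u (X v) = C (ω u v) := by simp [D, mkDerivation_X]

lemma D_comm (u v : V) (f : MvPolynomial V ℂ) : D ω u (D ω v f) = D ω v (D ω u f) := by
  have : ⁅D ω u, D ω v⁆ = 0 := by
    apply MvPolynomial.derivation_ext
    intro i
    simp [Derivation.commutator_apply, D_X]
  have h2 := congrArg (fun d => d f) this
  simpa [Derivation.commutator_apply, sub_eq_zero] using h2

/-- operators -/
noncomputable def L (v : V) : Module.End ℂ (MvPolynomial V ℂ) :=
  LinearMap.mulLeft ℂ (X v) + (1/2 : ℂ) • (D ω v).toLinearMap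

lemma L_apply (v : V) (f : MvPolynomial V ℂ) : L ω v f = X v * f + C (1/2 : ℂ) * D ω v f := by
  simp only [L, LinearMap.add_apply, LinearMap.mulLeft_apply, LinearMap.smul_apply, smul_eq_C_mul]
  rfl

lemma L_comm (halt : ∀ v : V, ω v v = 0) (u v : V) :
    L ω u * L ω v = L ω v * L ω u + algebraMap ℂ _ (ω u v) := by
  have hs : ω v u = - ω u v := by
    have := halt (u + v)
    simp only [map_add, LinearMap.add_apply, halt] at this
    linear_combination this
  have hC : (C (1/2 : ℂ) : MvPolynomial V ℂ) * 2 = 1 := by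
    rw [show (2 : MvPolynomial V ℂ) = C 2 from (map_ofNat C 2).symm, ← C_mul]; simp
  have hD : ∀ w f, D ω w (C (1/2 : ℂ) * f) = C (1/2 : ℂ) * D ω w f := by
    intro w f; rw [← smul_eq_C_mul, ← smul_eq_C_mul, Derivation.map_smul]
  refine LinearMap.ext fun f => ?_
  simp only [Module.End.mul_apply, LinearMap.add_apply, Module.algebraMap_end_apply, L_apply,
    map_add, Derivation.leibniz, hD, D_X, smul_eq_mul, hs, smul_eq_C_mul, D_comm ω u v, C_neg]
  linear_combination (C (ω u v) * f) * hC

variable (halt : ∀ v : V, ω v v = 0)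

/-- representation -/
noncomputable def rho : WeylAlgebra ω →ₐ[ℂ] Module.End ℂ (MvPolynomial V ℂ) :=
  RingQuot.liftAlgHom ℂ ⟨FreeAlgebra.lift ℂ (L ω), by
    rintro _ _ ⟨u, v⟩
    simpa using L_comm ω halt u v⟩

lemma rho_gen (v : V) : rho ω halt (weylGen ω v) = L ω v := by
  simp [rho, weylGen]

/-- symbol -/
noncomputable def sg (n : ℕ) : WeylAlgebra ω →ₗ[ℂ] MvPolynomial V ℂ :=
  (homogeneousComponent n) ∘ₗ (LinearMap.applyₗ (1 : MvPolynomial V ℂ)) ∘ₗ (rho ω halt).toLinearMap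

lemma sg_apply (n : ℕ) (w : WeylAlgebra ω) :
    sg ω halt n w = homogeneousComponent n (rho ω halt w 1) := rfl

lemma D_deg (v : V) (f : MvPolynomial V ℂ) : (D ω v f).totalDegree ≤ f.totalDegree := by
  conv_lhs => rw [f.as_sum, map_sum]
  refine totalDegree_finsetSum_le fun m hm => ?_
  rw [D, mkDerivation_monomial]
  refine (totalDegree_smul_le _ _).trans ?_
  refine totalDegree_finsetSum_le fun i hi => ?_
  simp only [smul_eq_mul]
  refine (totalDegree_mul _ _).trans ?_
  rw [totalDegree_C, add_zero]
  refine (totalDegree_monomial_le _ _).trans ?_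
  refine le_trans ?_ (le_totalDegree hm)
  have : (m - Finsupp.single i 1) ≤ m := tsub_le_self
  have h2 := Finsupp.degree_mono this
  exact h2

lemma hc_lt {f : MvPolynomial V ℂ} {n : ℕ} (h : f.totalDegree < n) :
    homogeneousComponent n f = 0 := homogeneousComponent_eq_zero n f h

lemma rho_gp (l : List V) : (rho ω halt (gp ω l) 1).totalDegree ≤ l.length ∧
    homogeneousComponent l.length (rho ω halt (gp ω l) 1) = (l.map X).prod := by
  induction l with
  | nil => simp [gp_nil]
  | cons v l ih =>
    obtain ⟨h1, h2⟩ := ih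
    rw [gp_cons, map_mul, Module.End.mul_apply, rho_gen, L_apply]
    set f := rho ω halt (gp ω l) 1
    have hD : (C (1/2 : ℂ) * D ω v f).totalDegree ≤ l.length := by
      refine (totalDegree_mul _ _).trans ?_
      rw [totalDegree_C, zero_add]
      exact (D_deg ω v f).trans h1
    constructor
    · refine (totalDegree_add _ _).trans (max_le ?_ (hD.trans (by simp)))
      refine (totalDegree_mul _ _).trans ?_
      rw [totalDegree_X, List.length_cons]; omega
    · rw [map_add, hc_lt (f := C (1/2 : ℂ) * D ω v f) (by rw [List.length_cons]; omega), add_zero]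
      rw [List.length_cons, List.map_cons, List.prod_cons, ← h2]
      classical
      ext m
      rw [coeff_homogeneousComponent, coeff_X_mul', coeff_X_mul']
      simp only [coeff_homogeneousComponent]
      by_cases hv : v ∈ m.support
      · rw [if_pos hv, if_pos hv]
        have : m.degree = (m - Finsupp.single v 1).degree + 1 := by
          have h1 : m - Finsupp.single v 1 + Finsupp.single v 1 = m := by
            apply tsub_add_cancel_of_le
            rw [Finsupp.single_le_iff]
            exact Nat.one_le_iff_ne_zero.2 (Finsupp.mem_support_iff.1 hv)
          conv_lhs => rw [← h1]
          rw [map_add, Finsupp.degree_single]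
        simp [this]
      · simp [hv]

lemma sg_gp_eq (l : List V) : sg ω halt l.length (gp ω l) = (l.map X).prod := (rho_gp ω halt l).2

lemma sg_gp_lt {l : List V} {n : ℕ} (h : l.length < n) : sg ω halt n (gp ω l) = 0 :=
  hc_lt (((rho_gp ω halt l).1).trans_lt h)

lemma sg_G {n : ℕ} {w : WeylAlgebra ω} (h : w ∈ G ω n) : sg ω halt n w = 0 := by
  have : G ω n ≤ LinearMap.ker (sg ω halt n) := by
    refine Submodule.span_le.2 ?_
    rintro _ ⟨l, hl, rfl⟩
    exact sg_gp_lt ω halt hl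
  exact this h

/-- ordered section -/
noncomputable def q : MvPolynomial V ℂ →ₗ[ℂ] WeylAlgebra ω :=
  (basisMonomials V ℂ).constr ℂ (fun m => gp ω (Finsupp.toMultiset m).toList)

lemma q_prod (l : List V) : q ω (l.map X).prod = gp ω ((l : Multiset V).toList) := by
  classical
  have h : ((l.map X).prod : MvPolynomial V ℂ) = basisMonomials V ℂ (Multiset.toFinsupp (l : Multiset V)) := by
    rw [coe_basisMonomials]
    induction l with
    | nil => simp
    | cons v l ih =>
      rw [List.map_cons, List.prod_cons, ih, ← Multiset.cons_coe, ← Multiset.singleton_add, map_add,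
        Multiset.toFinsupp_singleton, X, monomial_mul, one_mul]
  rw [h, q, Module.Basis.constr_basis, Multiset.toFinsupp_toMultiset]

lemma sub_q {n : ℕ} {w : WeylAlgebra ω} (h : w ∈ weylFil ω n) :
    w - q ω (sg ω halt n w) ∈ G ω n := by
  have : weylFil ω n ≤ (G ω n).comap (LinearMap.id - (q ω) ∘ₗ (sg ω halt n)) := by
    refine Submodule.span_le.2 ?_
    rintro _ ⟨l, hl, rfl⟩
    change gp ω l - q ω (sg ω halt n (gp ω l)) ∈ G ω n
    rcases hl.lt_or_eq with hl | rfl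
    · rw [sg_gp_lt ω halt hl, map_zero, sub_zero]
      exact fil_le_G ω hl (gp_mem ω l)
    · rw [sg_gp_eq, q_prod]
      exact perm_sub ω (Multiset.coe_eq_coe.1 (by simp))
  exact this h

lemma mem_G_of_sg {n : ℕ} {w : WeylAlgebra ω} (h : w ∈ weylFil ω n) (h0 : sg ω halt n w = 0) :
    w ∈ G ω n := by
  simpa [h0] using sub_q ω halt h

lemma sg_mul {n m : ℕ} {w w' : WeylAlgebra ω} (h : w ∈ weylFil ω n) (h' : w' ∈ weylFil ω m) :
    sg ω halt (n+m) (w * w') = sg ω halt n w * sg ω halt m w' := by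
  induction h using Submodule.span_induction with
  | zero => simp
  | add x y _ _ hx hy => simp [add_mul, hx, hy]
  | smul c x _ hx => simp [hx]
  | mem x hx =>
    obtain ⟨l, hl, rfl⟩ := hx
    change sg ω halt (n+m) (gp ω l * w') = sg ω halt n (gp ω l) * sg ω halt m w'
    induction h' using Submodule.span_induction with
    | zero => simp
    | add x y _ _ hx hy => simp [mul_add, hx, hy]
    | smul c x _ hx => simp [hx]
    | mem x hx =>
      obtain ⟨l', hl', rfl⟩ := hx
      change sg ω halt (n+m) (gp ω l * gp ω l') = sg ω halt n (gp ω l) * sg ω halt m (gp ω l')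
      rw [← gp_append]
      rcases hl.lt_or_eq with hl | rfl
      · rw [sg_gp_lt ω halt hl, zero_mul, sg_gp_lt]
        rw [List.length_append]; omega
      · rcases hl'.lt_or_eq with hl' | rfl
        · rw [sg_gp_lt ω halt hl', mul_zero, sg_gp_lt]
          rw [List.length_append]; omega
        · rw [← List.length_append, sg_gp_eq, sg_gp_eq, sg_gp_eq, List.map_append, List.prod_append]



lemma mem_G_of_mul {n m : ℕ} {x y : WeylAlgebra ω} (halt : ∀ v : V, ω v v = 0)
    (hx : x ∈ weylFil ω n) (hy : y ∈ weylFil ω m)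
    (h : x * y ∈ G ω (n + m)) (hy' : y ∉ G ω m) : x ∈ G ω n := by
  have h1 := sg_G ω halt h
  rw [sg_mul ω halt hx hy, mul_eq_zero] at h1
  rcases h1 with h1 | h1
  · exact mem_G_of_sg ω halt hx h1
  · exact absurd (mem_G_of_sg ω halt hy h1) hy'

lemma comm_mem {n m : ℕ} {x y : WeylAlgebra ω} (halt : ∀ v : V, ω v v = 0)
    (hx : x ∈ weylFil ω n) (hy : y ∈ weylFil ω m) : x * y - y * x ∈ G ω (n + m) := by
  have hyx := fil_mul ω hy hx
  rw [add_comm] at hyx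
  refine mem_G_of_sg ω halt (Submodule.sub_mem _ (fil_mul ω hx hy) hyx) ?_
  have h2 := sg_mul ω halt hy hx
  rw [add_comm] at h2
  rw [map_sub, sg_mul ω halt hx hy, h2]
  ring

open Classical in
/-- degree -/
noncomputable def dg (x : WeylAlgebra ω) : ℕ := Nat.find (exists_fil ω x)

lemma mem_dg (x : WeylAlgebra ω) : x ∈ weylFil ω (dg ω x) := by
  classical
  exact Nat.find_spec (exists_fil ω x)

lemma dg_le {x : WeylAlgebra ω} {n : ℕ} (h : x ∈ weylFil ω n) : dg ω x ≤ n := by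
  classical
  exact Nat.find_min' (exists_fil ω x) h

lemma dg_lt {x : WeylAlgebra ω} {n : ℕ} (h : x ∈ G ω n) (h0 : x ≠ 0) : dg ω x < n := by
  cases n with
  | zero => rw [G_zero] at h; exact absurd ((Submodule.mem_bot ℂ).1 h) h0
  | succ n => rw [← fil_eq] at h; exact Nat.lt_succ_of_le (dg_le ω h)

lemma mem_G_of_dg {x : WeylAlgebra ω} {n : ℕ} (h : x ≠ 0 → dg ω x < n) : x ∈ G ω n := by
  by_cases h0 : x = 0
  · rw [h0]; exact Submodule.zero_mem _
  · exact fil_le_G ω (h h0) (mem_dg ω x)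

lemma dg_smul_le (c : ℂ) (x : WeylAlgebra ω) : dg ω (c • x) ≤ dg ω x :=
  dg_le ω (Submodule.smul_mem _ _ (mem_dg ω x))

lemma dg_smul {c : ℂ} (hc : c ≠ 0) (x : WeylAlgebra ω) : dg ω (c • x) = dg ω x := by
  refine le_antisymm (dg_smul_le ω c x) ?_
  have := dg_smul_le ω c⁻¹ (c • x)
  rwa [inv_smul_smul₀ hc] at this

lemma pow_der (halt : ∀ v : V, ω v v = 0) {x a : WeylAlgebra ω} {d k : ℕ}
    (ha : a ∈ weylFil ω d) (hk : x * a - a * x ∈ weylFil ω k) (j : ℕ) :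
    x * a ^ (j+1) - a ^ (j+1) * x - ((j + 1 : ℕ) : ℂ) • (a ^ j * (x * a - a * x)) ∈ G ω (j * d + k) := by
  induction j with
  | zero => simp
  | succ j ih =>
    have e : x * a ^ (j+1+1) - a ^ (j+1+1) * x
        - ((j + 1 + 1 : ℕ) : ℂ) • (a ^ (j+1) * (x * a - a * x)) =
        ((x * a - a * x) * a ^ (j+1) - a ^ (j+1) * (x * a - a * x)) +
        a * (x * a ^ (j+1) - a ^ (j+1) * x - ((j + 1 : ℕ) : ℂ) • (a ^ j * (x * a - a * x))) := by
      rw [mul_sub a _ (_ • _), mul_smul_comm, ← mul_assoc a (a ^ j), ← pow_succ' a j,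
        Nat.cast_succ (j+1), add_smul, one_smul, pow_succ' a (j+1)]
      generalize a ^ (j+1) = p
      generalize ((j + 1 : ℕ) : ℂ) • (p * (x * a - a * x)) = t
      simp only [mul_sub, sub_mul, mul_assoc]
      abel
    rw [e]
    refine Submodule.add_mem _ ?_ ?_
    · have := comm_mem ω halt hk (fil_pow ω ha (j+1))
      rwa [add_comm] at this
    · have := fil_mul_G ω ha ih
      rwa [show d + (j * d + k) = (j+1) * d + k by ring] at this

lemma key (halt : ∀ v : V, ω v v = 0) (A Z : Subalgebra ℂ (WeylAlgebra ω)) (hZA : Z ≤ A)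
    (hcentral : ∀ z ∈ Z, ∀ a ∈ A, z * a = a * z) {x a : WeylAlgebra ω} (hx : x ∈ A) (haA : a ∈ A)
    {d k : ℕ} (ha : a ∈ weylFil ω d) (hk : x * a - a * x ∈ weylFil ω k)
    (hk' : x * a - a * x ∉ G ω k)
    (hG : ∀ b ∈ A, ∀ N, b ∈ G ω (N + d) → x * b - b * x ∈ G ω (N + k)) (m : ℕ) :
    ∀ (N : ℕ) (z : ℕ → WeylAlgebra ω), (∀ j, z j ∈ Z) →
      (∀ j < m, z j ≠ 0 → dg ω (z j) + j * d ≤ N) →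
      ∑ j ∈ Finset.range m, z j * a ^ j ∈ G ω N →
      ∀ j < m, z j ≠ 0 → dg ω (z j) + j * d < N := by
  induction m with
  | zero => intro N z _ _ _ j hj; omega
  | succ m ih =>
    intro N z hz hle hS
    have hc : ∀ j : ℕ, ((j + 1 : ℕ) : ℂ) ≠ 0 := fun j => Nat.cast_ne_zero.2 (Nat.succ_ne_zero j)
    have hpos : ∀ j < m, z (j+1) ≠ 0 → dg ω (z (j+1)) + (j+1) * d < N := by
      by_cases hN : d ≤ N
      · obtain ⟨N', rfl⟩ := Nat.exists_eq_add_of_le' hN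
        set z' : ℕ → WeylAlgebra ω := fun j => ((j + 1 : ℕ) : ℂ) • z (j+1) with hz'
        have hz'0 : ∀ j, z (j+1) ≠ 0 → z' j ≠ 0 := fun j h => smul_ne_zero (hc j) h
        have hz'1 : ∀ j, z' j ≠ 0 → z (j+1) ≠ 0 := by
          intro j h h0; apply h; simp [hz', h0]
        have hdg : ∀ j, dg ω (z' j) = dg ω (z (j+1)) := fun j => dg_smul ω (hc j) _
        have hle' : ∀ j < m, z' j ≠ 0 → dg ω (z' j) + j * d ≤ N' := by
          intro j hj h
          have := hle (j+1) (by omega) (hz'1 j h)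
          rw [hdg]; rw [add_mul] at this; omega
        have hT : ∑ j ∈ Finset.range m, z' j * a ^ j ∈ weylFil ω N' := by
          refine Submodule.sum_mem _ fun j hj => ?_
          by_cases h0 : z' j = 0
          · rw [h0, zero_mul]; exact Submodule.zero_mem _
          · exact fil_mono ω (hle' j (Finset.mem_range.1 hj) h0)
              (fil_mul ω (mem_dg ω _) (fil_pow ω ha j))
        have hTd : (∑ j ∈ Finset.range m, z' j * a ^ j) * (x * a - a * x) ∈ G ω (N' + k) := by
          have hSA : ∑ j ∈ Finset.range (m+1), z j * a ^ j ∈ A :=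
            Subalgebra.sum_mem _ fun j _ => A.mul_mem (hZA (hz j)) (A.pow_mem haA j)
          have h1 := hG _ hSA N' hS
          have h2 : ∑ j ∈ Finset.range m, z (j+1) * (x * a ^ (j+1) - a ^ (j+1) * x
              - ((j + 1 : ℕ) : ℂ) • (a ^ j * (x * a - a * x))) ∈ G ω (N' + k) := by
            refine Submodule.sum_mem _ fun j hj => ?_
            by_cases h0 : z (j+1) = 0
            · rw [h0, zero_mul]; exact Submodule.zero_mem _
            · refine G_mono ω ?_ (fil_mul_G ω (mem_dg ω _) (pow_der ω halt ha hk j))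
              have := hle' j (Finset.mem_range.1 hj) (hz'0 j h0)
              rw [hdg] at this
              omega
          have h3 := Submodule.sub_mem _ h1 h2
          convert h3 using 1
          rw [Finset.sum_range_succ', Finset.sum_mul, mul_add, add_mul, Finset.mul_sum,
            Finset.sum_mul]
          have e0 : x * (z 0 * a ^ 0) = z 0 * a ^ 0 * x := by
            simp [hcentral _ (hz 0) x hx]
          rw [e0, add_sub_add_right_eq_sub, ← Finset.sum_sub_distrib, ← Finset.sum_sub_distrib]
          refine Finset.sum_congr rfl fun j _ => ?_
          rw [← mul_assoc x, ← hcentral _ (hz (j+1)) x hx]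
          simp only [hz', mul_sub, smul_sub, smul_mul_assoc, mul_smul_comm, mul_assoc]
          abel
        have hTG := mem_G_of_mul ω halt hT hk hTd hk'
        intro j hj h0
        have := ih N' z' (fun j => Z.smul_mem (hz _) _) hle' hTG j hj (hz'0 j h0)
        rw [hdg] at this
        rw [add_mul]; omega
      · intro j hj h0
        have := hle (j+1) (by omega) h0
        rw [add_mul] at this; omega
    intro j hj h0
    cases j with
    | succ j => exact hpos j (by omega) h0
    | zero =>
      rw [zero_mul, add_zero]
      refine dg_lt ω ?_ h0
      rw [Finset.sum_range_succ', pow_zero, mul_one] at hS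
      refine (Submodule.add_mem_iff_right _ ?_).1 hS
      refine Submodule.sum_mem _ fun j hj => ?_
      by_cases h0 : z (j+1) = 0
      · rw [h0, zero_mul]; exact Submodule.zero_mem _
      · exact fil_le_G ω (hpos j (Finset.mem_range.1 hj) h0)
          (fil_mul ω (mem_dg ω _) (fil_pow ω ha _))

lemma integral_rel {R B : Type*} [CommRing R] [Ring B] (f : R →+* B)
    (hf : ∀ r b, f r * b = b * f r) {ι : Type*} [Fintype ι] (g : ι → B)
    (hg : ∀ b : B, ∃ c : ι → R, b = ∑ i, f (c i) * g i) (b : B) :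
    ∃ (m : ℕ) (z : ℕ → R), z m = 1 ∧ ∑ j ∈ Finset.range (m+1), f (z j) * b ^ j = 0 := by
  classical
  letI : Algebra R B := f.toAlgebra' hf
  have hfin : Module.Finite R B := by
    refine ⟨⟨Finset.univ.image g, ?_⟩⟩
    rw [eq_top_iff]
    intro b _
    obtain ⟨c, rfl⟩ := hg b
    refine Submodule.sum_mem _ fun i _ => ?_
    have : f (c i) * g i = c i • g i := by rw [Algebra.smul_def]; rfl
    rw [this]
    exact Submodule.smul_mem _ _ (Submodule.subset_span (by simp))
  obtain ⟨p, hp, hpb⟩ := Algebra.IsIntegral.isIntegral (R := R) b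
  refine ⟨p.natDegree, p.coeff, hp, ?_⟩
  rw [Polynomial.eval₂_eq_sum_range] at hpb
  exact hpb

end WeylAux

/-- If `A` is a filtered subalgebra of the Weyl algebra `W(V)` and `Z ⊆ A` a central
subalgebra such that `gr A` is a finite `gr Z`-module (witnessed by finitely many
generators `aᵢ` of degrees `dᵢ`: every `x ∈ A` of degree `≤ n` agrees, modulo degree
`≤ n−1`, with a combination `Σ zᵢaᵢ` with `zᵢ ∈ Z` of degree `≤ n − dᵢ`),
then `A` is commutative. -/
theorem weyl_subalgebra_gr_finite_over_central_commutative
    (V : Type*) [AddCommGroup V] [Module ℂ V] [FiniteDimensional ℂ V]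
    (ω : V →ₗ[ℂ] V →ₗ[ℂ] ℂ)
    (halt : ∀ v : V, ω v v = 0)
    (hnondeg : ∀ v : V, (∀ w : V, ω v w = 0) → v = 0)
    (A Z : Subalgebra ℂ (WeylAlgebra ω))
    (hZA : Z ≤ A)
    (hcentral : ∀ z ∈ Z, ∀ a ∈ A, z * a = a * z)
    (hfin : ∃ (r : ℕ) (a : Fin r → WeylAlgebra ω) (d : Fin r → ℕ),
      (∀ i, a i ∈ A) ∧ (∀ i, a i ∈ weylFil ω (d i)) ∧
      ∀ (n : ℕ), ∀ x ∈ A, x ∈ weylFil ω n →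
        ∃ z : Fin r → WeylAlgebra ω,
          (∀ i, z i ∈ Z ∧ z i ∈ weylFil ω (n - d i)) ∧
          x - ∑ i, z i * a i ∈ weylFil ω (n - 1)) :
    ∀ x ∈ A, ∀ y ∈ A, x * y = y * x := by
  classical
  obtain ⟨r, g, d, hgA, -, hspan⟩ := hfin
  -- `A` is generated over `Z` by `1` and the `g i`
  have hgen : ∀ n, ∀ x ∈ A, x ∈ weylFil ω n → ∃ c : Option (Fin r) → WeylAlgebra ω,
      (∀ i, c i ∈ Z) ∧ x = ∑ i, c i * (i.elim 1 g : WeylAlgebra ω) := by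
    intro n
    induction n with
    | zero =>
      intro x _ hx0
      obtain ⟨c, rfl⟩ := WeylAux.fil_zero ω hx0
      refine ⟨fun i => i.elim (algebraMap ℂ _ c) (fun _ => 0), ?_, ?_⟩
      · rintro (_ | i)
        · exact Z.algebraMap_mem c
        · exact Z.zero_mem
      · simp [Fintype.sum_option]
    | succ n ih =>
      intro x hxA hxn
      obtain ⟨z, hz, hzx⟩ := hspan (n+1) x hxA hxn
      have hsA : ∑ i, z i * g i ∈ A :=
        Subalgebra.sum_mem _ fun i _ => A.mul_mem (hZA (hz i).1) (hgA i)
      obtain ⟨c, hc, hcx⟩ := ih _ (A.sub_mem hxA hsA) hzx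
      refine ⟨fun i => c i + i.elim 0 z, ?_, ?_⟩
      · rintro (_ | i)
        · exact Z.add_mem (hc _) Z.zero_mem
        · exact Z.add_mem (hc _) (hz i).1
      · rw [sub_eq_iff_eq_add] at hcx
        rw [hcx]
        simp [Fintype.sum_option, add_mul, Finset.sum_add_distrib, add_assoc]
  -- every element of `A` is integral over `Z`
  have hint : ∀ b ∈ A, ∃ (m : ℕ) (z : ℕ → WeylAlgebra ω), (∀ j, z j ∈ Z) ∧ z m = 1 ∧
      ∑ j ∈ Finset.range (m+1), z j * b ^ j = 0 := by
    intro b hb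
    let instZ : CommRing Z := { (inferInstance : Ring Z) with
      mul_comm := fun u v => Subtype.ext (hcentral u u.2 v (hZA v.2)) }
    have hgO : ∀ i : Option (Fin r), (i.elim 1 g : WeylAlgebra ω) ∈ A := by
      rintro (_ | i)
      · exact A.one_mem
      · exact hgA i
    obtain ⟨m, z, hz1, hz2⟩ := WeylAux.integral_rel (R := Z) (B := A)
      (Subalgebra.inclusion hZA).toRingHom
      (fun u v => Subtype.ext (hcentral u u.2 v v.2))
      (fun i : Option (Fin r) => (⟨i.elim 1 g, hgO i⟩ : A))
      (by
        rintro ⟨y, hy⟩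
        obtain ⟨n, hn⟩ := WeylAux.exists_fil ω y
        obtain ⟨c, hc, hcy⟩ := hgen n y hy hn
        refine ⟨fun i => ⟨c i, hc i⟩, Subtype.ext ?_⟩
        rw [AddSubmonoidClass.coe_finset_sum]
        exact hcy) ⟨b, hb⟩
    refine ⟨m, fun j => (z j : WeylAlgebra ω), fun j => (z j).2, ?_, ?_⟩
    · exact congrArg Subtype.val hz1
    · have := congrArg Subtype.val hz2
      rw [AddSubmonoidClass.coe_finset_sum] at this
      exact this
  intro x hx y hy
  by_contra hxy
  -- choose `a` on which `ad x` raises the degree the most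
  have hne : ∃ n, ∃ b ∈ A, x * b - b * x ≠ 0 ∧
      n + WeylAux.dg ω (x * b - b * x) = WeylAux.dg ω b + WeylAux.dg ω x := by
    have h0 : x * y - y * x ≠ 0 := sub_ne_zero.2 hxy
    have := WeylAux.dg_lt ω
      (WeylAux.comm_mem ω halt (WeylAux.mem_dg ω x) (WeylAux.mem_dg ω y)) h0
    exact ⟨WeylAux.dg ω y + WeylAux.dg ω x - WeylAux.dg ω (x * y - y * x), y, hy, h0, by omega⟩
  obtain ⟨a, haA, ha0, hadeg⟩ := Nat.find_spec hne
  have hmax : ∀ b ∈ A, x * b - b * x ≠ 0 →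
      WeylAux.dg ω (x * b - b * x) + WeylAux.dg ω a ≤
        WeylAux.dg ω b + WeylAux.dg ω (x * a - a * x) := by
    intro b hb h0
    have := WeylAux.dg_lt ω
      (WeylAux.comm_mem ω halt (WeylAux.mem_dg ω x) (WeylAux.mem_dg ω b)) h0
    have h2 := Nat.find_min' hne
      ⟨b, hb, h0, (by omega : (WeylAux.dg ω b + WeylAux.dg ω x - WeylAux.dg ω (x * b - b * x))
        + WeylAux.dg ω (x * b - b * x) = WeylAux.dg ω b + WeylAux.dg ω x)⟩
    omega
  obtain ⟨m, z, hzZ, hzm, hrel⟩ := hint a haA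
  have h1 : (1 : WeylAlgebra ω) ≠ 0 := by
    intro h
    apply ha0
    rw [← one_mul (x * a - a * x), h, zero_mul]
  obtain ⟨i, hi, himax⟩ := Finset.exists_max_image
    ((Finset.range (m+1)).filter (fun j => z j ≠ 0))
    (fun j => WeylAux.dg ω (z j) + j * WeylAux.dg ω a)
    ⟨m, by simp [hzm, h1]⟩
  rw [Finset.mem_filter, Finset.mem_range] at hi
  have := WeylAux.key ω halt A Z hZA hcentral hx haA (WeylAux.mem_dg ω a) (WeylAux.mem_dg ω _)
    (fun h => lt_irrefl _ (WeylAux.dg_lt ω h ha0))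
    (fun b hb N hbN => WeylAux.mem_G_of_dg ω fun h0 => by
      have hb0 : b ≠ 0 := by
        rintro rfl
        simp at h0
      have h3 := WeylAux.dg_lt ω hbN hb0
      have h4 := hmax b hb h0
      omega)
    (m+1) _ z hzZ
    (fun j hj h0 => himax j (Finset.mem_filter.2 ⟨Finset.mem_range.2 hj, h0⟩))
    (by rw [hrel]; exact Submodule.zero_mem _) i hi.1 hi.2
  exact lt_irrefl _ this
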